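/- The map Φ_{p,q}(r e^{iθ}) = (r^{√(pq)}/√(p+q)) (√q e^{ipθ}, i√p e^{-iqθ}) is Lagrangian: the pullback of the standard symplectic form ω = dx₁∧dy₁ + dx₂∧dy₂ on ℂ² under Φ_{p,q} vanishes identically, i.e., ω(∂_r Φ_{p,q}, ∂_θ Φ_{p,q}) = 0 for all r > 0 and θ. -/

import Mathlib

/-- The Schoen–Wolfson cone parametrization `Φ_{p,q}` in polar coordinates. -/
noncomputable def SWPhi (p q : ℕ) (r θ : ℝ) : ℂ × ℂ :=
  ( ((r ^ Real.sqrt ((p : ℝ) * q) / Real.sqrt ((p : ℝ) + q) * Real.sqrt q : ℝ) : ℂ) *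
      Complex.exp (Complex.I * p * θ),
    ((r ^ Real.sqrt ((p : ℝ) * q) / Real.sqrt ((p : ℝ) + q) * Real.sqrt p : ℝ) : ℂ) *
      Complex.I * Complex.exp (-(Complex.I * q * θ)) )

/-- The standard symplectic form `ω = dx₁∧dy₁ + dx₂∧dy₂` on `ℂ²`:
`ω(u,v) = Im(conj(u₁) v₁) + Im(conj(u₂) v₂)`. -/
noncomputable def omegaStd (u v : ℂ × ℂ) : ℝ :=
  ((starRingEnd ℂ) u.1 * v.1).im + ((starRingEnd ℂ) u.2 * v.2).im

/-- `Φ_{p,q}` is Lagrangian: `ω(∂_r Φ, ∂_θ Φ) = 0` for all `r > 0` and `θ`. -/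
theorem swcone_lagrangian (p q : ℕ) (hp : 0 < p) (hq : 0 < q) (r θ : ℝ) (hr : 0 < r) :
    omegaStd (deriv (fun s => SWPhi p q s θ) r) (deriv (fun t => SWPhi p q r t) θ) = 0 := by
  obtain ⟨d, hd⟩ : ∃ d : ℝ, HasDerivAt (fun s : ℝ => s ^ Real.sqrt ((p : ℝ) * q)) d r :=
    ⟨_, Real.hasDerivAt_rpow_const (Or.inl hr.ne')⟩
  have h1 := ((((hd.div_const (Real.sqrt ((p : ℝ) + q))).mul_const
    (Real.sqrt q)).ofReal_comp).mul_const (Complex.exp (Complex.I * p * θ)))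
  have h2 := (((((hd.div_const (Real.sqrt ((p : ℝ) + q))).mul_const
    (Real.sqrt p)).ofReal_comp).mul_const Complex.I).mul_const
      (Complex.exp (-(Complex.I * q * θ))))
  have hr' := (h1.prodMk h2).deriv
  have hid : HasDerivAt (fun t : ℝ => (t : ℂ)) 1 θ := by
    simpa using (hasDerivAt_id θ).ofReal_comp
  have k1 := ((hid.const_mul (Complex.I * p)).cexp).const_mul
    (((r ^ Real.sqrt ((p : ℝ) * q) / Real.sqrt ((p : ℝ) + q) * Real.sqrt q : ℝ) : ℂ))
  have k2 := (((hid.const_mul (Complex.I * q)).neg).cexp).const_mul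
    (((r ^ Real.sqrt ((p : ℝ) * q) / Real.sqrt ((p : ℝ) + q) * Real.sqrt p : ℝ) : ℂ) * Complex.I)
  have hk := (k1.prodMk k2).deriv
  have e1 : deriv (fun s => SWPhi p q s θ) r = _ := hr'
  have e2 : deriv (fun t => SWPhi p q r t) θ = _ := hk
  rw [e1, e2]
  have E : (starRingEnd ℂ) (Complex.exp (Complex.I * p * θ)) * Complex.exp (Complex.I * p * θ)
      = 1 := by
    rw [← Complex.exp_conj, ← Complex.exp_add]; simp
  have F : (starRingEnd ℂ) (Complex.exp (-(Complex.I * q * θ))) *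
      Complex.exp (-(Complex.I * q * θ)) = 1 := by
    rw [← Complex.exp_conj, ← Complex.exp_add]; simp
  have sp : Real.sqrt p * Real.sqrt p = p := Real.mul_self_sqrt (Nat.cast_nonneg p)
  have sq : Real.sqrt q * Real.sqrt q = q := Real.mul_self_sqrt (Nat.cast_nonneg q)
  simp only [omegaStd, map_mul, Complex.conj_ofReal, Complex.conj_I]
  generalize Complex.exp (Complex.I * p * θ) = x at *
  generalize Complex.exp (-(Complex.I * q * θ)) = y at *
  generalize Real.sqrt ((p : ℝ) + q) = c at *
  generalize r ^ Real.sqrt ((p : ℝ) * q) = A at *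
  have t1 : ((d / c * √(q:ℝ) : ℝ) : ℂ) * (starRingEnd ℂ) x *
      (((A / c * √(q:ℝ) : ℝ) : ℂ) * (x * (Complex.I * p * 1)))
      = ((d / c * (A / c) * (√(q:ℝ) * √(q:ℝ)) * p : ℝ) : ℂ) * Complex.I := by
    push_cast
    linear_combination (d / c * (A / c) * ((√(q:ℝ) : ℝ) * (√(q:ℝ) : ℝ)) * p * Complex.I : ℂ) * E
  have t2 : ((d / c * √(p:ℝ) : ℝ) : ℂ) * -Complex.I * (starRingEnd ℂ) y *
      (((A / c * √(p:ℝ) : ℝ) : ℂ) * Complex.I * (y * -(Complex.I * q * 1)))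
      = ((-(d / c * (A / c) * (√(p:ℝ) * √(p:ℝ)) * q) : ℝ) : ℂ) * Complex.I := by
    push_cast
    linear_combination (d / c * (A / c) * ((√(p:ℝ) : ℝ) * (√(p:ℝ) : ℝ)) * q * Complex.I ^ 3 : ℂ) * F
      + (d / c * (A / c) * ((√(p:ℝ) : ℝ) * (√(p:ℝ) : ℝ)) * q * Complex.I : ℂ) * Complex.I_sq
  rw [t1, t2, Complex.im_ofReal_mul, Complex.im_ofReal_mul, sp, sq]
  ring
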